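/- Let ρ_AB be a density matrix on ℂ^{d_A} ⊗ ℂ^{d_B} with d_A, d_B ≥ 2, reduced states ρ_A, ρ_B, purities P_A = Tr[ρ_A²], P_B = Tr[ρ_B²], P_AB = Tr[ρ_AB²], and let d_AB = d_A d_B. Then for every finite-dimensional Hilbert space ℂ^{d_C} and every density matrix ρ_ABC on ℂ^{d_A} ⊗ ℂ^{d_B} ⊗ ℂ^{d_C} whose partial trace over C equals ρ_AB, one has (1/2) I(A:B|C) ≥ max{ L(P_A), L(P_B) } − U(P_AB, d_AB). -/

import Mathlib

open scoped Kronecker ComplexOrder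

/-- Von Neumann entropy (natural logarithm) of a matrix, via its eigenvalues
(`0` if the matrix is not Hermitian; `Real.log 0 = 0` handles zero eigenvalues). -/
noncomputable def vN {n : Type*} [Fintype n] [DecidableEq n] (ρ : Matrix n n ℂ) : ℝ :=
  if h : ρ.IsHermitian then -∑ i, h.eigenvalues i * Real.log (h.eigenvalues i) else 0

/-- Partial trace over the second tensor factor. -/
noncomputable def ptraceB {A B : Type*} [Fintype B] (ρ : Matrix (A × B) (A × B) ℂ) :
    Matrix A A ℂ := Matrix.of fun a a' => ∑ b, ρ (a, b) (a', b)

/-- Partial trace over the first tensor factor. -/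
noncomputable def ptraceA {A B : Type*} [Fintype A] (ρ : Matrix (A × B) (A × B) ℂ) :
    Matrix B B ℂ := Matrix.of fun b b' => ∑ a, ρ (a, b) (a, b')

/-- Partial trace over the third factor of a tripartite system `A × B × C`. -/
noncomputable def ptraceC3 {A B C : Type*} [Fintype C] (ρ : Matrix (A × B × C) (A × B × C) ℂ) :
    Matrix (A × B) (A × B) ℂ := Matrix.of fun x y => ∑ c, ρ (x.1, x.2, c) (y.1, y.2, c)

/-- Partial trace over the second factor of a tripartite system `A × B × C`. -/
noncomputable def ptraceB3 {A B C : Type*} [Fintype B] (ρ : Matrix (A × B × C) (A × B × C) ℂ) :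
    Matrix (A × C) (A × C) ℂ := Matrix.of fun x y => ∑ b, ρ (x.1, b, x.2) (y.1, b, y.2)

/-- Conditional mutual information `I(A:B|C) = S(ρ_AC) + S(ρ_BC) − S(ρ_ABC) − S(ρ_C)`. -/
noncomputable def condMutualInfo {A B C : Type*} [Fintype A] [DecidableEq A] [Fintype B]
    [DecidableEq B] [Fintype C] [DecidableEq C]
    (ρ : Matrix (A × B × C) (A × B × C) ℂ) : ℝ :=
  vN (ptraceB3 ρ) + vN (ptraceA ρ) - vN ρ - vN (ptraceA (ptraceA ρ))

/-- Lower bound `L(P)` on the entropy at fixed purity `P`, where `k` is the integer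
with `1/k ≤ P ≤ 1/(k−1)`: `L(P) = −[(1 − λ_k) ln λ₁ + λ_k ln λ_k]` with
`λ_k = 1/k − √((1 − 1/k)(P − 1/k))` and `λ₁ = (1 − λ_k)/(k − 1)`. -/
noncomputable def Lent (P : ℝ) (k : ℕ) : ℝ :=
  let lamk : ℝ := 1 / (k : ℝ) - Real.sqrt ((1 - 1 / (k : ℝ)) * (P - 1 / (k : ℝ)))
  let lam1 : ℝ := (1 - lamk) / ((k : ℝ) - 1);
  -((1 - lamk) * Real.log lam1 + lamk * Real.log lamk)

/-- Upper bound `U(P,d)` on the entropy at fixed purity `P` in dimension `d`: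
`U(P,d) = −[(1 − λ) ln((1 − λ)/(d − 1)) + λ ln λ]` with `λ = 1/d + √((1 − 1/d)(P − 1/d))`. -/
noncomputable def Uent (P : ℝ) (d : ℕ) : ℝ :=
  let lam : ℝ := 1 / (d : ℝ) + Real.sqrt ((1 - 1 / (d : ℝ)) * (P - 1 / (d : ℝ)));
  -((1 - lam) * Real.log ((1 - lam) / ((d : ℝ) - 1)) + lam * Real.log lam)

/-- The positive-part square controls `∑ x log x`. -/
noncomputable def ppKernel (s x : ℝ) : ℝ := (x ^ 2 - 2 * s * x - (max (x - s) 0) ^ 2) / s ^ 2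

lemma ppKernel_of_le {s x : ℝ} (hs : 0 < s) (h : s ≤ x) : ppKernel s x = -1 := by
  rw [ppKernel, max_eq_left (by linarith)]
  field_simp
  ring

lemma ppKernel_of_ge {s x : ℝ} (h : x ≤ s) :
    ppKernel s x = x ^ 2 / s ^ 2 - 2 * x * s / s ^ 2 := by
  rw [ppKernel, max_eq_right (by linarith)]
  ring

lemma hasIntegral_ppKernel {x : ℝ} (h0 : 0 ≤ x) (h1 : x ≤ 1) :
    IntervalIntegrable (fun s => ppKernel s x) MeasureTheory.volume 0 1 ∧
      ∫ s in (0 : ℝ)..1, ppKernel s x = 2 * (x * Real.log x) - x ^ 2 := by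
  rcases h0.eq_or_lt with rfl | hx
  · have h : Set.EqOn (fun _ : ℝ => (0 : ℝ)) (fun s => ppKernel s 0) (Set.uIoc 0 1) := by
      intro s hs
      rw [Set.uIoc_of_le zero_le_one] at hs
      simp only [ppKernel_of_ge hs.1.le]
      simp
    refine ⟨(intervalIntegrable_const (c := (0 : ℝ))).congr h, ?_⟩
    rw [← intervalIntegral.integral_congr_ae (.of_forall h)]
    simp
  · have hl : Set.EqOn (fun _ : ℝ => (-1 : ℝ)) (fun s => ppKernel s x) (Set.uIoc 0 x) := by
      intro s hs
      rw [Set.uIoc_of_le h0] at hs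
      simp only [ppKernel_of_le hs.1 hs.2]
    have hr : Set.EqOn (fun s : ℝ => x ^ 2 / s ^ 2 - 2 * x * s / s ^ 2)
        (fun s => ppKernel s x) (Set.uIoc x 1) := by
      intro s hs
      rw [Set.uIoc_of_le h1] at hs
      simp only [ppKernel_of_ge hs.1.le]
    have hil : IntervalIntegrable (fun s => ppKernel s x) MeasureTheory.volume 0 x :=
      (intervalIntegrable_const (c := (-1 : ℝ))).congr hl
    have hcr : IntervalIntegrable (fun s : ℝ => x ^ 2 / s ^ 2 - 2 * x * s / s ^ 2)
        MeasureTheory.volume x 1 := by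
      apply ContinuousOn.intervalIntegrable
      rw [Set.uIcc_of_le h1]
      have : ∀ s ∈ Set.Icc x 1, s ^ 2 ≠ 0 := fun s hs => by
        have : 0 < s := hx.trans_le hs.1
        positivity
      fun_prop (disch := assumption)
    have hir := hcr.congr hr
    refine ⟨hil.trans hir, ?_⟩
    rw [← intervalIntegral.integral_add_adjacent_intervals hil hir,
      ← intervalIntegral.integral_congr_ae (.of_forall hl),
      ← intervalIntegral.integral_congr_ae (.of_forall hr),
      intervalIntegral.integral_eq_sub_of_hasDerivAt
        (f := fun s => -(x ^ 2 / s) - 2 * x * Real.log s) (fun s hs => ?_) hcr]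
    · simp
      field_simp
      ring
    · rw [Set.uIcc_of_le h1] at hs
      have hs0 : s ≠ 0 := (hx.trans_le hs.1).ne'
      have h2 := (((hasDerivAt_inv hs0).const_mul (x ^ 2)).neg).sub
        ((Real.hasDerivAt_log hs0).const_mul (2 * x))
      refine (h2.congr_deriv ?_).congr_of_eventuallyEq (.of_forall fun y => ?_)
      · field_simp
      · simp [div_eq_mul_inv]

theorem sum_mul_log_le_of_sum_posPart_sq_le {ι κ : Type*} [Fintype ι] [Fintype κ]
    (p : ι → ℝ) (q : κ → ℝ) (hp : ∀ i, 0 ≤ p i ∧ p i ≤ 1) (hq : ∀ j, 0 ≤ q j ∧ q j ≤ 1)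
    (h1 : ∑ i, p i = ∑ j, q j) (h2 : ∑ i, p i ^ 2 = ∑ j, q j ^ 2)
    (h : ∀ s, 0 < s → s ≤ 1 → ∑ j, (max (q j - s) 0) ^ 2 ≤ ∑ i, (max (p i - s) 0) ^ 2) :
    ∑ i, p i * Real.log (p i) ≤ ∑ j, q j * Real.log (q j) := by
  have hP := fun i => hasIntegral_ppKernel (hp i).1 (hp i).2
  have hQ := fun j => hasIntegral_ppKernel (hq j).1 (hq j).2
  have hIP := intervalIntegral.integral_finsetSum (s := Finset.univ) fun i _ => (hP i).1
  have hIQ := intervalIntegral.integral_finsetSum (s := Finset.univ) fun i _ => (hQ i).1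
  have hmono : ∫ s in (0 : ℝ)..1, ∑ i, ppKernel s (p i) ≤
      ∫ s in (0 : ℝ)..1, ∑ j, ppKernel s (q j) := by
    refine intervalIntegral.integral_mono_on_of_le_Ioo zero_le_one ?_ ?_ fun s hs => ?_
    · simpa only [Finset.sum_fn] using IntervalIntegrable.sum Finset.univ fun i _ => (hP i).1
    · simpa only [Finset.sum_fn] using IntervalIntegrable.sum Finset.univ fun i _ => (hQ i).1
    · simp only [ppKernel, ← Finset.sum_div, Finset.sum_sub_distrib, ← Finset.mul_sum, h1, h2]
      have := h s hs.1 hs.2.le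
      gcongr
  rw [hIP, hIQ] at hmono
  simp only [(hP _).2, (hQ _).2, Finset.sum_sub_distrib, ← Finset.mul_sum, h2] at hmono
  linarith

lemma exists_excess {ι : Type*} (S : Finset ι) (u : ι → ℝ) (s : ℝ) (hs : 0 < s)
    (hu : ∀ i ∈ S, 0 ≤ u i) :
    ∃ (M : ℕ) (r : ℝ), 0 ≤ r ∧ r ≤ s ∧ 0 ≤ ∑ i ∈ S, u i - M * s - r ∧
      ∑ i ∈ S, u i ^ 2 - 2 * s * ∑ i ∈ S, u i - ∑ i ∈ S, (max (u i - s) 0) ^ 2 ≤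
        -(M * s ^ 2) + (r ^ 2 - 2 * s * r) ∧
      (∑ i ∈ S, u i - M * s - r) ^ 2 ≤ M * ∑ i ∈ S, (max (u i - s) 0) ^ 2 := by
  classical
  induction S using Finset.induction_on with
  | empty => exact ⟨0, 0, by simp [hs.le]⟩
  | insert a S ha ih =>
    obtain ⟨M, r, hr0, hr1, hE, hS, hQ⟩ := ih fun i hi => hu i (Finset.mem_insert_of_mem hi)
    have hua := hu a (Finset.mem_insert_self a S)
    simp only [Finset.sum_insert ha]
    have hQ0 : 0 ≤ ∑ i ∈ S, (max (u i - s) 0) ^ 2 := Finset.sum_nonneg fun i _ => sq_nonneg _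
    have hM : (0 : ℝ) ≤ M := M.cast_nonneg
    generalize ∑ i ∈ S, u i = T at *
    generalize ∑ i ∈ S, u i ^ 2 = R at *
    generalize ∑ i ∈ S, (max (u i - s) 0) ^ 2 = Q at *
    generalize u a = x at *
    rcases le_total s x with hx | hx
    · rw [max_eq_left (by linarith)]
      refine ⟨M + 1, r, hr0, hr1, ?_, ?_, ?_⟩
      · push_cast; linarith
      · push_cast; linarith
      · push_cast
        have he : 0 ≤ x - s := by linarith
        have hEE : x + T - (M + 1) * s - r = (T - M * s - r) + (x - s) := by ring
        rw [hEE]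
        generalize T - M * s - r = E at *
        generalize x - s = e at *
        have : 2 * E * e ≤ Q + M * e ^ 2 := by
          refine abs_le_of_sq_le_sq' ?_ (by positivity) |>.2
          nlinarith [sq_nonneg (Q - M * e ^ 2), mul_le_mul_of_nonneg_right hQ (sq_nonneg e)]
        nlinarith
    · rw [max_eq_right (by linarith)]
      rcases le_total (r + x) s with h | h
      · refine ⟨M, r + x, by linarith, h, by linarith, by nlinarith, ?_⟩
        convert hQ using 2 <;> ring
      · refine ⟨M + 1, r + x - s, by linarith, by linarith, ?_, ?_, ?_⟩
        · push_cast; linarith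
        · push_cast; nlinarith [mul_nonneg (sub_nonneg.2 hr1) (sub_nonneg.2 hx)]
        · push_cast
          have : x + T - (M + 1) * s - (r + x - s) = T - M * s - r := by ring
          rw [this]
          nlinarith

/-- Among nonnegative vectors with given sum and sum of squares, the positive-part squares are
smallest for `n` equal large entries and one small entry. -/
lemma posPart_sq_le_sum_posPart_sq {ι : Type*} [Fintype ι] (p : ι → ℝ) (hp : ∀ i, 0 ≤ p i)
    (n : ℕ) (hn : 1 ≤ n) (a b s : ℝ) (hs : 0 < s) (hb0 : 0 ≤ b) (hba : b ≤ a)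
    (h1 : ∑ i, p i = n * a + b)
    (h2 : ∑ i, p i ^ 2 = n * a ^ 2 + b ^ 2) :
    n * (max (a - s) 0) ^ 2 + (max (b - s) 0) ^ 2 ≤ ∑ i, (max (p i - s) 0) ^ 2 := by
  obtain ⟨M, r, hr0, hr1, hE, hS, hQ⟩ := exists_excess Finset.univ p s hs fun i _ => hp i
  have hQ0 : 0 ≤ ∑ i, (max (p i - s) 0) ^ 2 := Finset.sum_nonneg fun i _ => sq_nonneg _
  rw [h1] at hE hS hQ
  rw [h2] at hS
  generalize ∑ i, (max (p i - s) 0) ^ 2 = Q at *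
  have hn0 : (0 : ℝ) ≤ n := n.cast_nonneg
  rcases le_total a s with has | has
  · rw [max_eq_right (by linarith), max_eq_right (by linarith)]
    simpa using hQ0
  rw [max_eq_left (by linarith)]
  have ha : 0 ≤ n * (a - s) := mul_nonneg hn0 (by linarith)
  have hn1 : (1 : ℝ) ≤ n := by exact_mod_cast hn
  have hr2 : r ^ 2 - 2 * s * r ≤ 0 := by nlinarith
  rcases le_or_gt M n with hMn | hMn
  · have hMn' : (M : ℝ) ≤ n := by exact_mod_cast hMn
    have hnQ : (n * a + b - M * s - r) ^ 2 ≤ n * Q :=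
      hQ.trans (mul_le_mul_of_nonneg_right hMn' hQ0)
    rcases le_total b s with hbs | hbs
    · rw [max_eq_right (by linarith)]
      by_cases hcase : M = n ∧ b ≤ r
      · obtain ⟨rfl, hbr⟩ := hcase
        nlinarith [mul_nonneg (sub_nonneg.2 hbr) (by linarith : 0 ≤ 2 * s - b - r)]
      · have hMr : M * s + r ≤ n * s + b := by
          rcases hMn.eq_or_lt with rfl | hlt
          · have : r < b := by
              by_contra hrb
              exact hcase ⟨rfl, not_lt.1 hrb⟩
            linarith
          · have : (M : ℝ) + 1 ≤ n := by exact_mod_cast hlt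
            nlinarith
        have hsq : (n * (a - s)) ^ 2 ≤ n * Q :=
          (pow_le_pow_left₀ ha (by linarith) 2).trans hnQ
        have : n * (n * (a - s) ^ 2) ≤ n * Q := by linarith
        have := le_of_mul_le_mul_left this (by linarith)
        linarith
    · rw [max_eq_left (by linarith)]
      have hMs : M * s ≤ n * s := mul_le_mul_of_nonneg_right hMn' hs.le
      have hsq : (n * (a - s) + (b - s)) ^ 2 ≤ n * Q :=
        (pow_le_pow_left₀ (by linarith) (by linarith) 2).trans hnQ
      refine le_of_mul_le_mul_left (?_ : n * _ ≤ n * Q) (by linarith)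
      refine le_trans ?_ hsq
      nlinarith [mul_nonneg hn0 (mul_nonneg (sub_nonneg.2 hbs) (sub_nonneg.2 hba))]
  · have hMn' : (n : ℝ) + 1 ≤ M := by exact_mod_cast hMn
    have : (n + 1) * s ^ 2 ≤ M * s ^ 2 := mul_le_mul_of_nonneg_right hMn' (sq_nonneg s)
    have hb : (max (b - s) 0) ^ 2 ≤ (b - s) ^ 2 := by
      rcases max_cases (b - s) 0 with h | h
      · rw [h.1]
      · rw [h.1]; nlinarith
    nlinarith

/-- Among vectors with given sum and sum of squares, the positive-part squares are largest for
one large entry and `n` equal small entries. -/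
lemma sum_posPart_sq_le_posPart_sq {ι : Type*} [Fintype ι] (p : ι → ℝ)
    (n : ℕ) (hn : Fintype.card ι = n + 1) (a b s : ℝ) (hba : b ≤ a) (hpa : ∀ i, p i ≤ a)
    (h1 : ∑ i, p i = n * b + a) (h2 : ∑ i, p i ^ 2 = n * b ^ 2 + a ^ 2) :
    ∑ i, (max (p i - s) 0) ^ 2 ≤ n * (max (b - s) 0) ^ 2 + (max (a - s) 0) ^ 2 := by
  have hsq : ∀ c : ℝ, ∑ i, (p i - c) ^ 2 = n * (b - c) ^ 2 + (a - c) ^ 2 := by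
    intro c
    have : ∀ i, (p i - c) ^ 2 = p i ^ 2 - 2 * c * p i + c ^ 2 := fun i => by ring
    simp only [this, Finset.sum_add_distrib, Finset.sum_sub_distrib, ← Finset.mul_sum, h1, h2]
    simp [hn]
    ring
  rcases le_total a s with has | has
  · rw [Finset.sum_eq_zero fun i _ => by rw [max_eq_right (by linarith [hpa i])]; simp]
    positivity
  rcases le_total s b with hsb | hsb
  · rw [max_eq_left (sub_nonneg.2 hsb), max_eq_left (sub_nonneg.2 has), ← hsq]
    refine Finset.sum_le_sum fun i _ => ?_
    rcases max_cases (p i - s) 0 with h | h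
    · rw [h.1]
    · rw [h.1]; nlinarith
  rw [max_eq_left (sub_nonneg.2 has), max_eq_right (sub_nonpos.2 hsb)]
  rcases hba.eq_or_lt with rfl | hlt
  · obtain rfl : b = s := le_antisymm hsb has
    rw [Finset.sum_eq_zero fun i _ => by rw [max_eq_right (by linarith [hpa i])]; simp]
    simp
  have hab : 0 < (a - b) ^ 2 := by have := sub_pos.2 hlt; positivity
  have hkey : ∀ i, (a - b) ^ 2 * (max (p i - s) 0) ^ 2 ≤ (a - s) ^ 2 * (p i - b) ^ 2 := by
    intro i
    rcases max_cases (p i - s) 0 with h | h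
    · rw [h.1, ← mul_pow, ← mul_pow]
      refine pow_le_pow_left₀ (mul_nonneg (by linarith) (by linarith)) ?_ 2
      nlinarith [mul_nonneg (sub_nonneg.2 hsb) (sub_nonneg.2 (hpa i))]
    · rw [h.1]
      simp only [ne_eq, OfNat.ofNat_ne_zero, not_false_eq_true, zero_pow, mul_zero]
      positivity
  have hsum := Finset.sum_le_sum fun i (_ : i ∈ Finset.univ) => hkey i
  rw [← Finset.mul_sum, ← Finset.mul_sum, hsq b] at hsum
  refine le_of_mul_le_mul_left (hsum.trans_eq ?_) hab
  ring

theorem Lent_le {ι : Type*} [Fintype ι] (p : ι → ℝ) (hp : ∀ i, 0 ≤ p i) (h1 : ∑ i, p i = 1)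
    (P : ℝ) (h2 : ∑ i, p i ^ 2 = P) (k : ℕ) (hk : 2 ≤ k) (hk1 : 1 / (k : ℝ) ≤ P)
    (hk2 : P ≤ 1 / ((k : ℝ) - 1)) : Lent P k ≤ -∑ i, p i * Real.log (p i) := by
  obtain ⟨n, rfl⟩ : ∃ n, k = n + 1 := ⟨k - 1, by omega⟩
  have hn : 1 ≤ n := by omega
  have hn1 : (1 : ℝ) ≤ n := by exact_mod_cast hn
  unfold Lent
  simp only
  push_cast at hk1 hk2 ⊢
  rw [add_sub_cancel_right] at hk2 ⊢
  set r := Real.sqrt ((1 - 1 / ((n : ℝ) + 1)) * (P - 1 / ((n : ℝ) + 1))) with hr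
  have hr0 : 0 ≤ r := Real.sqrt_nonneg _
  have hfac : 1 - 1 / ((n : ℝ) + 1) = n / (n + 1) := by field_simp; ring
  have hrsq : r ^ 2 = n / (n + 1) * (P - 1 / (n + 1)) := by
    rw [hr, Real.sq_sqrt, hfac]
    rw [hfac]
    exact mul_nonneg (by positivity) (by linarith)
  have hb0 : r ≤ 1 / (n + 1) := by
    refine abs_le_of_sq_le_sq' ?_ (by positivity) |>.2
    rw [hrsq]
    calc (n : ℝ) / (n + 1) * (P - 1 / (n + 1)) ≤ n / (n + 1) * (1 / n - 1 / (n + 1)) := by gcongr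
      _ = (1 / ((n : ℝ) + 1)) ^ 2 := by field_simp; ring
  have hP : P = (n + 1) / n * r ^ 2 + 1 / (n + 1) := by rw [hrsq]; field_simp; ring
  set b := 1 / ((n : ℝ) + 1) - r with hb
  set a := (1 - b) / n with ha
  have hsum : n * a + b = 1 := by rw [ha]; field_simp; ring
  have hasub : a = 1 / (n + 1) + r / n := by rw [ha, hb]; field_simp; ring
  have hsq : n * a ^ 2 + b ^ 2 = P := by rw [hP, hasub, hb]; field_simp; ring
  have hba : b ≤ a := by
    rw [hasub, hb]
    have : 0 ≤ r / n := by positivity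
    linarith
  have hbnn : 0 ≤ b := by linarith
  have ha1 : a ≤ 1 := by nlinarith
  have hsumO : ∀ f : ℝ → ℝ, ∑ j : Option (Fin n), f (j.elim b fun _ => a) = n * f a + f b := by
    intro f
    simp [Fintype.sum_option]
    ring
  have hle := sum_mul_log_le_of_sum_posPart_sq_le p
    (fun j : Option (Fin n) => j.elim b fun _ => a)
    (fun i => ⟨hp i, h1 ▸ Finset.single_le_sum (fun j _ => hp j) (Finset.mem_univ i)⟩)
    (by rintro (_ | _) <;> constructor <;> simp <;> linarith)
    (by rw [hsumO fun x => x, h1, hsum]) (by rw [hsumO fun x => x ^ 2, h2, hsq])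
    (fun s hs _ => by
      rw [hsumO fun x => (max (x - s) 0) ^ 2]
      exact posPart_sq_le_sum_posPart_sq p hp n hn a b s hs hbnn hba
        (by rw [h1, hsum]) (by rw [h2, hsq]))
  rw [hsumO fun x => x * Real.log x] at hle
  have : 1 - b = n * a := by linarith
  rw [this]
  linarith

theorem le_Uent {ι : Type*} [Fintype ι] (p : ι → ℝ) (hp : ∀ i, 0 ≤ p i) (h1 : ∑ i, p i = 1)
    (P : ℝ) (h2 : ∑ i, p i ^ 2 = P) (d : ℕ) (hd : 2 ≤ d) (hcard : Fintype.card ι = d) :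
    -∑ i, p i * Real.log (p i) ≤ Uent P d := by
  obtain ⟨n, rfl⟩ : ∃ n, d = n + 1 := ⟨d - 1, by omega⟩
  have hn : 1 ≤ n := by omega
  have hn1 : (1 : ℝ) ≤ n := by exact_mod_cast hn
  have hp1 : ∀ i, p i ≤ 1 := fun i =>
    h1 ▸ Finset.single_le_sum (fun j _ => hp j) (Finset.mem_univ i)
  have hk1 : 1 / ((n : ℝ) + 1) ≤ P := by
    have := sq_sum_le_card_mul_sum_sq (s := Finset.univ) (f := p)
    rw [h1, h2, Finset.card_univ, hcard] at this
    push_cast at this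
    rw [div_le_iff₀ (by positivity)]
    linarith
  have hP1 : P ≤ 1 := by
    rw [← h2, ← h1]
    exact Finset.sum_le_sum fun i _ => by nlinarith [hp i, hp1 i]
  unfold Uent
  simp only
  push_cast
  rw [add_sub_cancel_right]
  set r := Real.sqrt ((1 - 1 / ((n : ℝ) + 1)) * (P - 1 / ((n : ℝ) + 1))) with hr
  have hr0 : 0 ≤ r := Real.sqrt_nonneg _
  have hfac : 1 - 1 / ((n : ℝ) + 1) = n / (n + 1) := by field_simp; ring
  have hrsq : r ^ 2 = n / (n + 1) * (P - 1 / (n + 1)) := by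
    rw [hr, Real.sq_sqrt, hfac]
    rw [hfac]
    exact mul_nonneg (by positivity) (by linarith)
  have hr1 : r ≤ n / (n + 1) := by
    refine abs_le_of_sq_le_sq' ?_ (by positivity) |>.2
    rw [hrsq]
    calc (n : ℝ) / (n + 1) * (P - 1 / (n + 1)) ≤ n / (n + 1) * (1 - 1 / (n + 1)) := by gcongr
      _ = ((n : ℝ) / (n + 1)) ^ 2 := by rw [hfac]; ring
  have hP : P = (n + 1) / n * r ^ 2 + 1 / (n + 1) := by rw [hrsq]; field_simp; ring
  set a := 1 / ((n : ℝ) + 1) + r with ha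
  set b := (1 - a) / n with hb
  have hsum : n * b + a = 1 := by rw [hb]; field_simp; ring
  have hbsub : b = 1 / (n + 1) - r / n := by rw [hb, ha]; field_simp; ring
  have hsq : n * b ^ 2 + a ^ 2 = P := by rw [hP, hbsub, ha]; field_simp; ring
  have hba : b ≤ a := by
    rw [hbsub, ha]
    have : 0 ≤ r / n := by positivity
    linarith
  have ha1 : a ≤ 1 := by linarith
  have hbnn : 0 ≤ b := div_nonneg (by linarith) (by linarith)
  have hpa : ∀ i, p i ≤ a := by
    classical
    intro i
    have hcs := sq_sum_le_card_mul_sum_sq (s := Finset.univ.erase i) (f := p)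
    rw [Finset.card_erase_of_mem (Finset.mem_univ i), Finset.card_univ, hcard,
      Nat.add_sub_cancel] at hcs
    have e1 := Finset.add_sum_erase Finset.univ p (Finset.mem_univ i)
    have e2 := Finset.add_sum_erase Finset.univ (fun i => p i ^ 2) (Finset.mem_univ i)
    rw [h1] at e1
    rw [h2] at e2
    rw [show ∑ j ∈ Finset.univ.erase i, p j = 1 - p i by linarith,
      show ∑ j ∈ Finset.univ.erase i, p j ^ 2 = P - p i ^ 2 by linarith] at hcs
    suffices p i - 1 / (n + 1) ≤ r by linarith
    refine abs_le_of_sq_le_sq' ?_ hr0 |>.2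
    rw [hrsq]
    have : (n + 1) ^ 2 * (p i - 1 / (n + 1)) ^ 2 ≤
        (n + 1) ^ 2 * (n / (n + 1) * (P - 1 / ((n : ℝ) + 1))) := by
      have e3 : ((n : ℝ) + 1) ^ 2 * (p i - 1 / (n + 1)) ^ 2 = ((n + 1) * p i - 1) ^ 2 := by
        field_simp
      have e4 : ((n : ℝ) + 1) ^ 2 * (n / (n + 1) * (P - 1 / ((n : ℝ) + 1))) =
          n * ((n + 1) * P - 1) := by field_simp
      rw [e3, e4]
      nlinarith
    exact le_of_mul_le_mul_left this (by positivity)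
  have hsumO : ∀ f : ℝ → ℝ, ∑ j : Option (Fin n), f (j.elim a fun _ => b) = n * f b + f a := by
    intro f
    simp [Fintype.sum_option]
    ring
  have hle := sum_mul_log_le_of_sum_posPart_sq_le
    (fun j : Option (Fin n) => j.elim a fun _ => b) p
    (by rintro (_ | _) <;> constructor <;> simp <;> linarith)
    (fun i => ⟨hp i, hp1 i⟩)
    (by rw [hsumO fun x => x, h1, hsum]) (by rw [hsumO fun x => x ^ 2, h2, hsq])
    (fun s _ _ => by
      rw [hsumO fun x => (max (x - s) 0) ^ 2]
      exact sum_posPart_sq_le_posPart_sq p n hcard a b s hba hpa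
        (by rw [h1, hsum]) (by rw [h2, hsq]))
  rw [hsumO fun x => x * Real.log x] at hle
  have : 1 - a = n * b := by linarith
  rw [this]
  linarith

section RelativeEntropy

variable {n m : Type*} [Fintype n] [Fintype m]

open Matrix

/-- `ρ` is diagonalized by the unitary `U` with (real) spectrum `p`. -/
def IsDiagonalizedBy [DecidableEq n] (ρ U : Matrix n n ℂ) (p : n → ℝ) : Prop :=
  Uᴴ * U = 1 ∧ U * Uᴴ = 1 ∧ ρ = U * diagonal (fun i => (p i : ℂ)) * Uᴴ

/-- The quadratic functional whose maximum over `Y` is the resolvent quasi-entropy. -/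
noncomputable def quasiForm (t : ℝ) (ρ σ Y : Matrix n n ℂ) : ℝ :=
  2 * (Yᴴ * ρ).trace.re - (1 - t) * (Yᴴ * Y * ρ).trace.re - t * (Y * Yᴴ * σ).trace.re

/-- The resolvent quasi-entropy in terms of two diagonalizations. -/
noncomputable def quasiEntropy (t : ℝ) (U V : Matrix n n ℂ) (p q : n → ℝ) : ℝ :=
  ∑ j, ∑ i, Complex.normSq ((Vᴴ * U) j i) * (p i ^ 2 / ((1 - t) * p i + t * q j))

/-- Relative entropy in terms of two diagonalizations. -/
noncomputable def diagRelEntropy (U V : Matrix n n ℂ) (p q : n → ℝ) : ℝ :=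
  ∑ j, ∑ i, Complex.normSq ((Vᴴ * U) j i) * (p i * (Real.log (p i) - Real.log (q j)))

lemma quasiForm_conj [DecidableEq n] (t : ℝ) {ρ σ U V : Matrix n n ℂ} {p q : n → ℝ}
    (hρ : IsDiagonalizedBy ρ U p) (hσ : IsDiagonalizedBy σ V q) (Z : Matrix n n ℂ) :
    quasiForm t ρ σ (V * Z * Uᴴ) =
      ∑ j, ∑ i, (2 * p i * ((starRingEnd ℂ) (Z j i) * (Vᴴ * U) j i).re -
        ((1 - t) * p i + t * q j) * Complex.normSq (Z j i)) := by
  obtain ⟨hU, hU', rfl⟩ := hρ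
  obtain ⟨hV, hV', rfl⟩ := hσ
  have e1 : ((V * Z * Uᴴ)ᴴ * (U * diagonal (fun i => (p i : ℂ)) * Uᴴ)).trace =
      ∑ j, ∑ i, (p i : ℂ) * ((starRingEnd ℂ) (Z j i) * (Vᴴ * U) j i) := by
    have : (V * Z * Uᴴ)ᴴ * (U * diagonal (fun i => (p i : ℂ)) * Uᴴ) =
        U * (Zᴴ * (Vᴴ * U) * diagonal (fun i => (p i : ℂ)) * Uᴴ) := by
      simp only [conjTranspose_mul, conjTranspose_conjTranspose, Matrix.mul_assoc]
    rw [this, trace_mul_comm, Matrix.mul_assoc, hU, Matrix.mul_one, Finset.sum_comm]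
    simp only [trace, diag_apply, mul_diagonal]
    refine Finset.sum_congr rfl fun i _ => ?_
    rw [Matrix.mul_apply, Finset.sum_mul]
    refine Finset.sum_congr rfl fun j _ => ?_
    simp only [conjTranspose_apply, RCLike.star_def]
    ring
  have e2 : ((V * Z * Uᴴ)ᴴ * (V * Z * Uᴴ) * (U * diagonal (fun i => (p i : ℂ)) * Uᴴ)).trace =
      ∑ j, ∑ i, ((p i * Complex.normSq (Z j i) : ℝ) : ℂ) := by
    have : (V * Z * Uᴴ)ᴴ * (V * Z * Uᴴ) * (U * diagonal (fun i => (p i : ℂ)) * Uᴴ) =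
        U * (Zᴴ * ((Vᴴ * V) * (Z * ((Uᴴ * U) * (diagonal (fun i => (p i : ℂ)) * Uᴴ))))) := by
      simp only [conjTranspose_mul, conjTranspose_conjTranspose, Matrix.mul_assoc]
    rw [this, hU, hV, Matrix.one_mul, Matrix.one_mul, trace_mul_comm, ← Matrix.mul_assoc,
      ← Matrix.mul_assoc, Matrix.mul_assoc, hU, Matrix.mul_one, Finset.sum_comm]
    simp only [trace, diag_apply, mul_diagonal]
    refine Finset.sum_congr rfl fun i _ => ?_
    rw [Matrix.mul_apply, Finset.sum_mul]
    refine Finset.sum_congr rfl fun j _ => ?_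
    simp only [conjTranspose_apply, RCLike.star_def]
    push_cast
    rw [Complex.normSq_eq_conj_mul_self]
    ring
  have e3 : ((V * Z * Uᴴ) * (V * Z * Uᴴ)ᴴ * (V * diagonal (fun i => (q i : ℂ)) * Vᴴ)).trace =
      ∑ j, ∑ i, ((q j * Complex.normSq (Z j i) : ℝ) : ℂ) := by
    have : (V * Z * Uᴴ) * (V * Z * Uᴴ)ᴴ * (V * diagonal (fun i => (q i : ℂ)) * Vᴴ) =
        V * (Z * ((Uᴴ * U) * (Zᴴ * ((Vᴴ * V) * (diagonal (fun i => (q i : ℂ)) * Vᴴ))))) := by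
      simp only [conjTranspose_mul, conjTranspose_conjTranspose, Matrix.mul_assoc]
    rw [this, hU, hV, Matrix.one_mul, Matrix.one_mul, trace_mul_comm, ← Matrix.mul_assoc,
      ← Matrix.mul_assoc, Matrix.mul_assoc, hV, Matrix.mul_one]
    simp only [trace, diag_apply, mul_diagonal]
    refine Finset.sum_congr rfl fun i _ => ?_
    rw [Matrix.mul_apply, Finset.sum_mul]
    refine Finset.sum_congr rfl fun j _ => ?_
    simp only [conjTranspose_apply, RCLike.star_def]
    push_cast
    rw [Complex.normSq_eq_conj_mul_self]
    ring
  rw [quasiForm, e1, e2, e3]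
  simp only [Complex.re_sum, Complex.ofReal_re, Complex.re_ofReal_mul, Finset.mul_sum,
    ← Finset.sum_sub_distrib]
  refine Finset.sum_congr rfl fun j _ => Finset.sum_congr rfl fun i _ => ?_
  ring

lemma mix_pos {t x y : ℝ} (ht0 : 0 ≤ t) (ht1 : t ≤ 1) (hx : 0 < x) (hy : 0 < y) :
    0 < (1 - t) * x + t * y := by
  rcases ht0.eq_or_lt with rfl | h
  · simpa
  · have := mul_nonneg (sub_nonneg.2 ht1) hx.le
    positivity

lemma quasiForm_le [DecidableEq n] {t : ℝ} (ht0 : 0 ≤ t) (ht1 : t ≤ 1) {ρ σ U V : Matrix n n ℂ} {p q : n → ℝ}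
    (hρ : IsDiagonalizedBy ρ U p) (hσ : IsDiagonalizedBy σ V q) (hp : ∀ i, 0 < p i)
    (hq : ∀ i, 0 < q i) (Y : Matrix n n ℂ) :
    quasiForm t ρ σ Y ≤ quasiEntropy t U V p q := by
  have hY : Y = V * (Vᴴ * Y * U) * Uᴴ := by
    have : V * (Vᴴ * Y * U) * Uᴴ = (V * Vᴴ) * Y * (U * Uᴴ) := by simp only [Matrix.mul_assoc]
    rw [this, hσ.2.1, hρ.2.1, Matrix.one_mul, Matrix.mul_one]
  rw [hY, quasiForm_conj t hρ hσ]
  refine Finset.sum_le_sum fun j _ => Finset.sum_le_sum fun i _ => ?_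
  have hD := mix_pos ht0 ht1 (hp i) (hq j)
  generalize (1 - t) * p i + t * q j = D at *
  generalize (Vᴴ * Y * U) j i = z
  generalize (Vᴴ * U) j i = w
  rw [mul_div_assoc', le_div_iff₀ hD]
  simp only [Complex.normSq_apply, Complex.mul_re, Complex.conj_re, Complex.conj_im]
  nlinarith [sq_nonneg (p i * w.re - D * z.re), sq_nonneg (p i * w.im - D * z.im)]

lemma exists_quasiForm_eq [DecidableEq n] {t : ℝ} (ht0 : 0 ≤ t) (ht1 : t ≤ 1) {ρ σ U V : Matrix n n ℂ}
    {p q : n → ℝ} (hρ : IsDiagonalizedBy ρ U p) (hσ : IsDiagonalizedBy σ V q)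
    (hp : ∀ i, 0 < p i) (hq : ∀ i, 0 < q i) :
    ∃ Y, quasiForm t ρ σ Y = quasiEntropy t U V p q := by
  refine ⟨V * (Matrix.of fun j i =>
    ((p i / ((1 - t) * p i + t * q j) : ℝ) : ℂ) * (Vᴴ * U) j i) * Uᴴ, ?_⟩
  rw [quasiForm_conj t hρ hσ]
  refine Finset.sum_congr rfl fun j _ => Finset.sum_congr rfl fun i _ => ?_
  have hD := (mix_pos ht0 ht1 (hp i) (hq j)).ne'
  simp only [of_apply]
  generalize (1 - t) * p i + t * q j = D at *
  generalize (Vᴴ * U) j i = w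
  simp only [Complex.normSq_ofReal, map_mul, Complex.conj_ofReal,
    mul_assoc, Complex.re_ofReal_mul]
  simp only [Complex.normSq_apply, Complex.mul_re, Complex.conj_re, Complex.conj_im]
  field_simp
  ring

lemma sum_normSq_mul [DecidableEq n] {ρ U V : Matrix n n ℂ} {p : n → ℝ} (hρ : IsDiagonalizedBy ρ U p) (j : n) :
    ∑ i, Complex.normSq ((Vᴴ * U) j i) * p i = ((Vᴴ * ρ * V) j j).re := by
  obtain ⟨-, -, rfl⟩ := hρ
  have : Vᴴ * (U * diagonal (fun i => (p i : ℂ)) * Uᴴ) * V =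
      (Vᴴ * U) * diagonal (fun i => (p i : ℂ)) * (Vᴴ * U)ᴴ := by
    simp only [conjTranspose_mul, conjTranspose_conjTranspose, Matrix.mul_assoc]
  rw [this, Matrix.mul_apply, Complex.re_sum]
  refine Finset.sum_congr rfl fun i _ => ?_
  simp only [mul_diagonal, conjTranspose_apply, RCLike.star_def]
  rw [mul_right_comm, Complex.mul_conj, ← Complex.ofReal_mul, Complex.ofReal_re]

lemma sum_sum_normSq_mul [DecidableEq n] {ρ U V : Matrix n n ℂ} {p : n → ℝ} (hρ : IsDiagonalizedBy ρ U p)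
    (hV : V * Vᴴ = 1) :
    ∑ j, ∑ i, Complex.normSq ((Vᴴ * U) j i) * p i = ρ.trace.re := by
  simp only [sum_normSq_mul hρ]
  rw [← Complex.re_sum]
  change (Vᴴ * ρ * V).trace.re = _
  rw [trace_mul_comm, ← Matrix.mul_assoc, hV, Matrix.one_mul]

lemma sum_normSq_row [DecidableEq n] {U V : Matrix n n ℂ} (hU : Uᴴ * U = 1) (hV : V * Vᴴ = 1) (i : n) :
    ∑ j, Complex.normSq ((Vᴴ * U) j i) = 1 := by
  have h : ((Vᴴ * U)ᴴ * (Vᴴ * U)) i i = 1 := by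
    have : (Vᴴ * U)ᴴ * (Vᴴ * U) = Uᴴ * (V * Vᴴ) * U := by
      simp only [conjTranspose_mul, conjTranspose_conjTranspose, Matrix.mul_assoc]
    rw [this, hV, Matrix.mul_one, hU, one_apply_eq]
  rw [Matrix.mul_apply] at h
  have := congrArg Complex.re h
  rw [Complex.re_sum, Complex.one_re] at this
  rw [← this]
  refine Finset.sum_congr rfl fun j _ => ?_
  rw [conjTranspose_apply, RCLike.star_def, ← Complex.normSq_eq_conj_mul_self, Complex.ofReal_re]

lemma integral_log_div {x y : ℝ} (hx : 0 < x) (hy : 0 < y) :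
    ContinuousOn (fun t : ℝ => x * (x - y) / ((1 - t) * x + t * y)) (Set.uIcc 0 1) ∧
    ∫ t in (0 : ℝ)..1, x * (x - y) / ((1 - t) * x + t * y) =
      x * (Real.log x - Real.log y) := by
  rw [Set.uIcc_of_le zero_le_one]
  have hne : ∀ t ∈ Set.Icc (0 : ℝ) 1, (1 - t) * x + t * y ≠ 0 := fun t ht =>
    (mix_pos ht.1 ht.2 hx hy).ne'
  have hc : ContinuousOn (fun t : ℝ => x * (x - y) / ((1 - t) * x + t * y)) (Set.Icc 0 1) := by
    fun_prop (disch := assumption)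
  refine ⟨hc, ?_⟩
  rw [intervalIntegral.integral_eq_sub_of_hasDerivAt
    (f := fun t => -x * Real.log ((1 - t) * x + t * y))]
  · simp
    ring
  · intro t ht
    rw [Set.uIcc_of_le zero_le_one] at ht
    have h1 : HasDerivAt (fun t : ℝ => (1 - t) * x + t * y) (-1 * x + 1 * y) t :=
      (((hasDerivAt_id t).const_sub 1).mul_const x).add ((hasDerivAt_id t).mul_const y)
    refine ((h1.log (hne t ht)).const_mul (-x)).congr_deriv ?_
    ring
  · apply ContinuousOn.intervalIntegrable
    rwa [Set.uIcc_of_le zero_le_one]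

/-- The density over `t ∈ [0, 1]` of the relative entropy. -/
noncomputable def relEntropyDensity (t : ℝ) (U V : Matrix n n ℂ) (p q : n → ℝ) : ℝ :=
  ∑ j, ∑ i, Complex.normSq ((Vᴴ * U) j i) * (p i * (p i - q j) / ((1 - t) * p i + t * q j))

lemma intervalIntegrable_relEntropyDensity {U V : Matrix n n ℂ} {p q : n → ℝ}
    (hp : ∀ i, 0 < p i) (hq : ∀ i, 0 < q i) :
    IntervalIntegrable (fun t => relEntropyDensity t U V p q) MeasureTheory.volume 0 1 := by
  apply ContinuousOn.intervalIntegrable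
  refine continuousOn_finsetSum _ fun j _ => continuousOn_finsetSum _ fun i _ => ?_
  exact continuousOn_const.mul (integral_log_div (hp i) (hq j)).1

lemma diagRelEntropy_eq_integral {U V : Matrix n n ℂ} {p q : n → ℝ}
    (hp : ∀ i, 0 < p i) (hq : ∀ i, 0 < q i) :
    diagRelEntropy U V p q = ∫ t in (0 : ℝ)..1, relEntropyDensity t U V p q := by
  have hc : ∀ j i, ContinuousOn (fun t : ℝ => Complex.normSq ((Vᴴ * U) j i) *
      (p i * (p i - q j) / ((1 - t) * p i + t * q j))) (Set.uIcc 0 1) := fun j i =>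
    continuousOn_const.mul (integral_log_div (hp i) (hq j)).1
  simp only [relEntropyDensity]
  rw [intervalIntegral.integral_finsetSum fun j _ =>
    (continuousOn_finsetSum _ fun i _ => hc j i).intervalIntegrable]
  refine Finset.sum_congr rfl fun j _ => ?_
  rw [intervalIntegral.integral_finsetSum fun i _ => (hc j i).intervalIntegrable]
  refine Finset.sum_congr rfl fun i _ => ?_
  rw [intervalIntegral.integral_const_mul, (integral_log_div (hp i) (hq j)).2]

lemma mul_relEntropyDensity [DecidableEq n] {t : ℝ} (ht0 : 0 ≤ t) (ht1 : t ≤ 1) {ρ U V : Matrix n n ℂ}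
    {p q : n → ℝ} (hρ : IsDiagonalizedBy ρ U p) (hV : V * Vᴴ = 1) (hp : ∀ i, 0 < p i)
    (hq : ∀ i, 0 < q i) :
    t * relEntropyDensity t U V p q = quasiEntropy t U V p q - ρ.trace.re := by
  rw [← sum_sum_normSq_mul hρ hV]
  simp only [relEntropyDensity, quasiEntropy, Finset.mul_sum, ← Finset.sum_sub_distrib]
  refine Finset.sum_congr rfl fun j _ => Finset.sum_congr rfl fun i _ => ?_
  have hD := (mix_pos ht0 ht1 (hp i) (hq j)).ne'
  have : t * (p i * (p i - q j) / ((1 - t) * p i + t * q j)) =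
      p i ^ 2 / ((1 - t) * p i + t * q j) - p i := by
    rw [eq_sub_iff_add_eq, eq_div_iff hD, add_mul, mul_assoc, div_mul_cancel₀ _ hD]
    ring
  rw [mul_left_comm, this, mul_sub]

/-- Monotonicity of relative entropy under the adjoint of a star homomorphism. -/
theorem diagRelEntropy_mono [DecidableEq n] [DecidableEq m] {ρ σ U V : Matrix n n ℂ} {p q : n → ℝ}
    (hρ : IsDiagonalizedBy ρ U p) (hσ : IsDiagonalizedBy σ V q)
    (hp : ∀ i, 0 < p i) (hq : ∀ i, 0 < q i)
    {ρ' σ' U' V' : Matrix m m ℂ} {p' q' : m → ℝ}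
    (hρ' : IsDiagonalizedBy ρ' U' p') (hσ' : IsDiagonalizedBy σ' V' q')
    (hp' : ∀ i, 0 < p' i) (hq' : ∀ i, 0 < q' i)
    (E : Matrix m m ℂ → Matrix n n ℂ) (hE1 : E 1 = 1) (hEm : ∀ Y Z, E (Y * Z) = E Y * E Z)
    (hEs : ∀ Y, E Yᴴ = (E Y)ᴴ) (hEρ : ∀ Y, (E Y * ρ).trace = (Y * ρ').trace)
    (hEσ : ∀ Y, (E Y * σ).trace = (Y * σ').trace) :
    diagRelEntropy U' V' p' q' ≤ diagRelEntropy U V p q := by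
  have hform : ∀ t Y, quasiForm t ρ' σ' Y = quasiForm t ρ σ (E Y) := by
    intro t Y
    simp only [quasiForm, ← hEs, ← hEm, hEρ, hEσ]
  have hQ : ∀ t, 0 ≤ t → t ≤ 1 → quasiEntropy t U' V' p' q' ≤ quasiEntropy t U V p q := by
    intro t ht0 ht1
    obtain ⟨Y, hY⟩ := exists_quasiForm_eq ht0 ht1 hρ' hσ' hp' hq'
    rw [← hY, hform]
    exact quasiForm_le ht0 ht1 hρ hσ hp hq _
  have htr : ρ.trace = ρ'.trace := by simpa [hE1] using hEρ 1
  rw [diagRelEntropy_eq_integral hp hq, diagRelEntropy_eq_integral hp' hq']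
  refine intervalIntegral.integral_mono_on_of_le_Ioo zero_le_one
    (intervalIntegrable_relEntropyDensity hp' hq') (intervalIntegrable_relEntropyDensity hp hq)
    fun t ht => ?_
  refine le_of_mul_le_mul_left ?_ ht.1
  rw [mul_relEntropyDensity ht.1.le ht.2.le hρ hσ.2.1 hp hq,
    mul_relEntropyDensity ht.1.le ht.2.le hρ' hσ'.2.1 hp' hq', htr]
  exact sub_le_sub_right (hQ t ht.1.le ht.2.le) _

end RelativeEntropy

section StrongSubadditivity

open Matrix

variable {A B C N : Type*}

/-- The sum `∑ x log x`. -/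
noncomputable def sumMulLog {ι : Type*} [Fintype ι] (p : ι → ℝ) : ℝ := ∑ i, p i * Real.log (p i)

lemma IsDiagonalizedBy.one_kronecker [Fintype A] [DecidableEq A] [Fintype N] [DecidableEq N]
    {ρ V : Matrix N N ℂ} {q : N → ℝ}
    (h : IsDiagonalizedBy ρ V q) :
    IsDiagonalizedBy ((1 : Matrix A A ℂ) ⊗ₖ ρ) (1 ⊗ₖ V) (fun x => q x.2) := by
  obtain ⟨h1, h2, rfl⟩ := h
  have hd : (diagonal fun x : A × N => (q x.2 : ℂ)) =
      (1 : Matrix A A ℂ) ⊗ₖ diagonal (fun i => (q i : ℂ)) := by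
    rw [← diagonal_one, diagonal_kronecker_diagonal]
    simp
  refine ⟨?_, ?_, ?_⟩
  · rw [conjTranspose_kronecker, ← mul_kronecker_mul, h1, conjTranspose_one, Matrix.one_mul,
      one_kronecker_one]
  · rw [conjTranspose_kronecker, ← mul_kronecker_mul, h2, conjTranspose_one, Matrix.one_mul,
      one_kronecker_one]
  · rw [hd, conjTranspose_kronecker, ← mul_kronecker_mul, ← mul_kronecker_mul, conjTranspose_one,
      Matrix.one_mul, Matrix.one_mul]

lemma sum_one_kronecker_conj [Fintype A] [DecidableEq A] [Fintype N]
    (ρ : Matrix (A × N) (A × N) ℂ) (V : Matrix N N ℂ) (j : N) :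
    ∑ a, (((1 : Matrix A A ℂ) ⊗ₖ V)ᴴ * ρ * ((1 : Matrix A A ℂ) ⊗ₖ V) :
      Matrix (A × N) (A × N) ℂ) (a, j) (a, j) =
      (Vᴴ * ptraceA ρ * V) j j := by
  simp only [conjTranspose_kronecker, conjTranspose_one, Matrix.mul_apply, kroneckerMap_apply,
    one_apply, Fintype.sum_prod_type, ite_mul, mul_ite, one_mul, zero_mul, mul_zero,
    Finset.sum_ite_irrel, Finset.sum_const_zero, Finset.sum_ite_eq, Finset.sum_ite_eq',
    Finset.mem_univ, if_true, ptraceA, of_apply, Finset.mul_sum, Finset.sum_mul]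
  rw [Finset.sum_comm]
  refine Finset.sum_congr rfl fun x _ => ?_
  rw [Finset.sum_comm]

lemma diagRelEntropy_one_kronecker [Fintype A] [DecidableEq A] [Fintype N] [DecidableEq N]
    {ρ U : Matrix (A × N) (A × N) ℂ} {p : A × N → ℝ}
    (hρ : IsDiagonalizedBy ρ U p) {V : Matrix N N ℂ} {q : N → ℝ}
    (hq : IsDiagonalizedBy (ptraceA ρ) V q) :
    diagRelEntropy U ((1 : Matrix A A ℂ) ⊗ₖ V) p (fun x => q x.2) =
      sumMulLog p - sumMulLog q := by
  have hV := (hq.one_kronecker (A := A)).2.1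
  simp only [diagRelEntropy, mul_sub, Finset.sum_sub_distrib]
  congr 1
  · rw [Finset.sum_comm]
    simp only [← Finset.sum_mul, sum_normSq_row hρ.1 hV, one_mul, sumMulLog]
  · simp only [← mul_assoc, ← Finset.sum_mul, sum_normSq_mul hρ]
    rw [Fintype.sum_prod_type, Finset.sum_comm]
    refine Finset.sum_congr rfl fun j _ => ?_
    simp only [← Finset.sum_mul]
    rw [← Complex.re_sum, sum_one_kronecker_conj]
    congr 1
    obtain ⟨h1, -, h3⟩ := hq
    have : Vᴴ * (V * diagonal (fun i => (q i : ℂ)) * Vᴴ) * V =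
        (Vᴴ * V) * diagonal (fun i => (q i : ℂ)) * (Vᴴ * V) := by
      simp only [Matrix.mul_assoc]
    rw [h3, this, h1, Matrix.one_mul, Matrix.mul_one, diagonal_apply_eq, Complex.ofReal_re]

/-- Tensoring with the identity on the middle factor. -/
def embedMid (B : Type*) [DecidableEq B] {A C : Type*} (Y : Matrix (A × C) (A × C) ℂ) :
    Matrix (A × B × C) (A × B × C) ℂ :=
  Matrix.of fun x y => if x.2.1 = y.2.1 then Y (x.1, x.2.2) (y.1, y.2.2) else 0

lemma embedMid_one [DecidableEq A] [DecidableEq B] [DecidableEq C] :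
    embedMid B (1 : Matrix (A × C) (A × C) ℂ) = 1 := by
  ext ⟨a, b, c⟩ ⟨a', b', c'⟩
  simp only [embedMid, of_apply, one_apply, Prod.mk.injEq]
  split_ifs <;> simp_all

lemma embedMid_mul [Fintype A] [Fintype B] [DecidableEq B] [Fintype C]
    (Y Z : Matrix (A × C) (A × C) ℂ) :
    embedMid B (Y * Z) = embedMid B Y * embedMid B Z := by
  ext ⟨a, b, c⟩ ⟨a', b', c'⟩
  simp only [embedMid, of_apply, Matrix.mul_apply, Fintype.sum_prod_type, ite_mul, mul_ite,
    zero_mul, mul_zero]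
  split_ifs with h
  · subst h
    refine Finset.sum_congr rfl fun x _ => ?_
    rw [Finset.sum_comm]
    refine Finset.sum_congr rfl fun y _ => ?_
    rw [Finset.sum_eq_single b]
    · simp
    · intro z _ hz
      simp [hz]
    · simp
  · symm
    refine Finset.sum_eq_zero fun x _ => Finset.sum_eq_zero fun z _ => Finset.sum_eq_zero
      fun y _ => ?_
    split_ifs with h1 h2
    · exact absurd (h2.trans h1) h
    · rfl
    · rfl

lemma embedMid_conjTranspose [DecidableEq B] (Y : Matrix (A × C) (A × C) ℂ) :
    embedMid B Yᴴ = (embedMid B Y)ᴴ := by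
  ext ⟨a, b, c⟩ ⟨a', b', c'⟩
  simp only [embedMid, of_apply, conjTranspose_apply, eq_comm (a := b)]
  split_ifs <;> simp

lemma trace_embedMid_mul [Fintype A] [Fintype B] [DecidableEq B] [Fintype C]
    (Y : Matrix (A × C) (A × C) ℂ)
    (ρ : Matrix (A × B × C) (A × B × C) ℂ) :
    (embedMid B Y * ρ).trace = (Y * ptraceB3 ρ).trace := by
  simp only [trace, diag_apply, embedMid, ptraceB3, of_apply, Matrix.mul_apply,
    Fintype.sum_prod_type, ite_mul, zero_mul, Finset.mul_sum]
  refine Finset.sum_congr rfl fun a _ => ?_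
  rw [Finset.sum_comm]
  refine Finset.sum_congr rfl fun c _ => ?_
  rw [Finset.sum_comm]
  refine Finset.sum_congr rfl fun a' _ => ?_
  simp only [Finset.sum_ite_irrel, Finset.sum_const_zero, Finset.sum_ite_eq,
    Finset.mem_univ, if_true]
  rw [Finset.sum_comm]

lemma ptraceA_ptraceB3 [Fintype A] [Fintype B] (ρ : Matrix (A × B × C) (A × B × C) ℂ) :
    ptraceA (ptraceB3 ρ) = ptraceA (ptraceA ρ) := by
  ext c c'
  simp only [ptraceA, ptraceB3, of_apply]
  rw [Finset.sum_comm]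

lemma ptraceB3_one_kronecker [DecidableEq A] [Fintype B] (σ : Matrix (B × C) (B × C) ℂ) :
    ptraceB3 ((1 : Matrix A A ℂ) ⊗ₖ σ) = 1 ⊗ₖ ptraceA σ := by
  ext ⟨a, c⟩ ⟨a', c'⟩
  simp [ptraceA, ptraceB3, Finset.mul_sum]

/-- Strong subadditivity in terms of strictly positive spectra. -/
lemma sumMulLog_ssa [Fintype A] [DecidableEq A] [Fintype B] [DecidableEq B] [Fintype C]
    [DecidableEq C] {ρ U₁ : Matrix (A × B × C) (A × B × C) ℂ} {p₁ : A × B × C → ℝ}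
    {U₂ : Matrix (A × C) (A × C) ℂ} {p₂ : A × C → ℝ}
    {U₃ : Matrix (B × C) (B × C) ℂ} {p₃ : B × C → ℝ} {U₄ : Matrix C C ℂ} {p₄ : C → ℝ}
    (h₁ : IsDiagonalizedBy ρ U₁ p₁) (h₂ : IsDiagonalizedBy (ptraceB3 ρ) U₂ p₂)
    (h₃ : IsDiagonalizedBy (ptraceA ρ) U₃ p₃)
    (h₄ : IsDiagonalizedBy (ptraceA (ptraceA ρ)) U₄ p₄)
    (hp₁ : ∀ i, 0 < p₁ i) (hp₂ : ∀ i, 0 < p₂ i) (hp₃ : ∀ i, 0 < p₃ i) (hp₄ : ∀ i, 0 < p₄ i) :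
    sumMulLog p₂ - sumMulLog p₄ ≤ sumMulLog p₁ - sumMulLog p₃ := by
  rw [← diagRelEntropy_one_kronecker h₁ h₃,
    ← diagRelEntropy_one_kronecker h₂ (ptraceA_ptraceB3 ρ ▸ h₄)]
  refine diagRelEntropy_mono h₁ h₃.one_kronecker hp₁ (fun x => hp₃ _) h₂ h₄.one_kronecker hp₂
    (fun x => hp₄ _) (embedMid B) embedMid_one embedMid_mul embedMid_conjTranspose
    (fun Y => trace_embedMid_mul Y ρ) fun Y => ?_
  rw [trace_embedMid_mul, ptraceB3_one_kronecker]

lemma Matrix.IsHermitian.isDiagonalizedBy [Fintype N] [DecidableEq N]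
    {ρ : Matrix N N ℂ} (h : ρ.IsHermitian) :
    IsDiagonalizedBy ρ (h.eigenvectorUnitary : Matrix N N ℂ) h.eigenvalues := by
  refine ⟨?_, ?_, ?_⟩
  · exact (Matrix.mem_unitaryGroup_iff'.1 h.eigenvectorUnitary.2)
  · exact (Matrix.mem_unitaryGroup_iff.1 h.eigenvectorUnitary.2)
  · have := h.spectral_theorem
    rwa [Unitary.conjStarAlgAut_apply] at this

lemma IsDiagonalizedBy.add_smul_one [Fintype N] [DecidableEq N] {ρ U : Matrix N N ℂ} {p : N → ℝ}
    (h : IsDiagonalizedBy ρ U p) (c : ℝ) :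
    IsDiagonalizedBy (ρ + (c : ℂ) • 1) U (fun i => p i + c) := by
  obtain ⟨h1, h2, rfl⟩ := h
  refine ⟨h1, h2, ?_⟩
  have : (diagonal fun i => ((p i + c : ℝ) : ℂ)) =
      diagonal (fun i => (p i : ℂ)) + (c : ℂ) • (1 : Matrix N N ℂ) := by
    ext i j
    by_cases hij : i = j <;> simp [hij, one_apply]
  rw [this, Matrix.mul_add, Matrix.add_mul, Matrix.mul_smul, Matrix.smul_mul, Matrix.mul_one, h2]

lemma Matrix.PosSemidef.ptraceA [Fintype A] {ρ : Matrix (A × N) (A × N) ℂ} (h : ρ.PosSemidef) :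
    (_root_.ptraceA ρ).PosSemidef := by
  have : _root_.ptraceA ρ = ∑ a, ρ.submatrix (fun n => (a, n)) (fun n => (a, n)) := by
    ext
    simp [_root_.ptraceA, Matrix.sum_apply]
  rw [this]
  exact posSemidef_sum _ fun a _ => h.submatrix _

lemma Matrix.PosSemidef.ptraceB3 [Fintype B]
    {ρ : Matrix (A × B × C) (A × B × C) ℂ} (h : ρ.PosSemidef) :
    (_root_.ptraceB3 ρ).PosSemidef := by
  have : _root_.ptraceB3 ρ =
      ∑ b, ρ.submatrix (fun x => (x.1, b, x.2)) (fun x => (x.1, b, x.2)) := by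
    ext
    simp [_root_.ptraceB3, Matrix.sum_apply]
  rw [this]
  exact posSemidef_sum _ fun a _ => h.submatrix _

lemma ptraceA_add_smul_one [Fintype A] [DecidableEq A] [DecidableEq N]
    (ρ : Matrix (A × N) (A × N) ℂ) (c : ℝ) :
    ptraceA (ρ + (c : ℂ) • 1) = ptraceA ρ + ((Fintype.card A * c : ℝ) : ℂ) • 1 := by
  ext i j
  simp [ptraceA, one_apply, Finset.sum_add_distrib]

lemma ptraceB3_add_smul_one [DecidableEq A] [Fintype B] [DecidableEq B] [DecidableEq C]
    (ρ : Matrix (A × B × C) (A × B × C) ℂ) (c : ℝ) :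
    ptraceB3 (ρ + (c : ℂ) • 1) = ptraceB3 ρ + ((Fintype.card B * c : ℝ) : ℂ) • 1 := by
  ext ⟨a, i⟩ ⟨a', j⟩
  simp [ptraceB3, one_apply, Finset.sum_add_distrib]

lemma tendsto_sumMulLog {ι : Type*} [Fintype ι] (p : ι → ℝ) (c : ℝ) :
    Filter.Tendsto (fun ε : ℝ => sumMulLog fun i => p i + c * ε) (nhdsWithin 0 (Set.Ioi 0))
      (nhds (sumMulLog p)) := by
  have hc : Continuous fun ε : ℝ => sumMulLog fun i => p i + c * ε := by
    unfold sumMulLog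
    refine continuous_finsetSum _ fun i _ => ?_
    exact Real.continuous_mul_log.comp (by fun_prop : Continuous fun ε : ℝ => p i + c * ε)
  have := (hc.tendsto 0).mono_left (nhdsWithin_le_nhds (s := Set.Ioi 0))
  simpa using this

lemma vN_eq [Fintype N] [DecidableEq N]
    {ρ : Matrix N N ℂ} (h : ρ.IsHermitian) : vN ρ = -sumMulLog h.eigenvalues := by
  rw [vN, dif_pos h, sumMulLog]

/-- Strong subadditivity of the von Neumann entropy. -/
theorem condMutualInfo_nonneg [Fintype A] [DecidableEq A] [Fintype B] [DecidableEq B] [Fintype C]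
    [DecidableEq C] [Nonempty A] [Nonempty B] {ρ : Matrix (A × B × C) (A × B × C) ℂ}
    (h : ρ.PosSemidef) : 0 ≤ condMutualInfo ρ := by
  have h2 := h.ptraceB3
  have h3 := h.ptraceA
  have h4 := h3.ptraceA
  rw [condMutualInfo, vN_eq h.1, vN_eq h2.1, vN_eq h3.1, vN_eq h4.1]
  have hA : (0 : ℝ) < Fintype.card A := by exact_mod_cast Fintype.card_pos
  have hB : (0 : ℝ) < Fintype.card B := by exact_mod_cast Fintype.card_pos
  suffices sumMulLog h2.1.eigenvalues - sumMulLog h4.1.eigenvalues ≤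
      sumMulLog h.1.eigenvalues - sumMulLog h3.1.eigenvalues by linarith
  refine le_of_tendsto_of_tendsto
    ((tendsto_sumMulLog _ (Fintype.card B : ℝ)).sub
      (tendsto_sumMulLog _ ((Fintype.card B : ℝ) * Fintype.card A)))
    ((tendsto_sumMulLog _ 1).sub (tendsto_sumMulLog _ (Fintype.card A : ℝ))) ?_
  filter_upwards [self_mem_nhdsWithin] with ε hε
  have hε : 0 < ε := hε
  have d3 := h3.1.isDiagonalizedBy.add_smul_one (Fintype.card A * ε)
  have d4 := h4.1.isDiagonalizedBy.add_smul_one (Fintype.card B * (Fintype.card A * ε))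
  rw [← ptraceA_add_smul_one, ← ptraceA_add_smul_one] at d4
  rw [← ptraceA_add_smul_one] at d3
  have d2 := h2.1.isDiagonalizedBy.add_smul_one (Fintype.card B * ε)
  rw [← ptraceB3_add_smul_one] at d2
  simp only [mul_assoc, one_mul]
  exact sumMulLog_ssa (h.1.isDiagonalizedBy.add_smul_one ε) d2 d3 d4
    (fun i => add_pos_of_nonneg_of_pos (h.eigenvalues_nonneg i) hε)
    (fun i => add_pos_of_nonneg_of_pos (h2.eigenvalues_nonneg i) (by positivity))
    (fun i => add_pos_of_nonneg_of_pos (h3.eigenvalues_nonneg i) (by positivity))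
    (fun i => add_pos_of_nonneg_of_pos (h4.eigenvalues_nonneg i) (by positivity))

end StrongSubadditivity

section Spectrum

open Matrix

variable {m n : Type*} [Fintype m] [DecidableEq m] [Fintype n] [DecidableEq n]

lemma vN_eq_sum_roots {ρ : Matrix n n ℂ} (h : ρ.IsHermitian) :
    vN ρ = -(ρ.charpoly.roots.map fun z => z.re * Real.log z.re).sum := by
  rw [vN_eq h, h.roots_charpoly_eq_eigenvalues, Multiset.map_map]
  simp [sumMulLog, Function.comp_def]

lemma vN_submatrix_equiv {ρ : Matrix n n ℂ} (h : ρ.IsHermitian) (e : m ≃ n) :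
    vN (ρ.submatrix e e) = vN ρ := by
  rw [vN_eq_sum_roots h, vN_eq_sum_roots (h.submatrix e)]
  have := charpoly_reindex e.symm ρ
  rw [reindex_apply, Equiv.symm_symm] at this
  rw [this]

lemma vN_mul_conjTranspose_self (M : Matrix m n ℂ) : vN (M * Mᴴ) = vN (Mᴴ * M)ᵀ := by
  rw [vN_eq_sum_roots (isHermitian_mul_conjTranspose_self M),
    vN_eq_sum_roots (isHermitian_conjTranspose_mul_self M).transpose, charpoly_transpose]
  have h := congrArg (fun p : Polynomial ℂ =>
    (p.roots.map fun z => z.re * Real.log z.re).sum) (charpoly_mul_comm' M Mᴴ)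
  have hX (k : ℕ) (N : Polynomial ℂ) (hN : N.Monic) :
      ((Polynomial.X ^ k * N).roots.map fun z : ℂ => z.re * Real.log z.re).sum =
        (N.roots.map fun z : ℂ => z.re * Real.log z.re).sum := by
    rw [Polynomial.roots_mul ((Polynomial.monic_X_pow k).mul hN).ne_zero, Polynomial.roots_X_pow]
    simp [Multiset.map_nsmul, Multiset.sum_nsmul]
  simp only [hX _ _ (charpoly_monic _)] at h
  rw [h]

open scoped MatrixOrder Matrix.Norms.L2Operator in
lemma Matrix.PosSemidef.exists_eq_mul_conjTranspose_self {ρ : Matrix n n ℂ} (h : ρ.PosSemidef) :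
    ∃ M : Matrix n n ℂ, ρ = M * Mᴴ := by
  obtain ⟨N, rfl⟩ := CStarAlgebra.nonneg_iff_eq_star_mul_self.mp h.nonneg
  exact ⟨Nᴴ, by rw [conjTranspose_conjTranspose, star_eq_conjTranspose]⟩

lemma Matrix.IsHermitian.trace_mul_self_eq_sum {ρ : Matrix n n ℂ} (h : ρ.IsHermitian) :
    (ρ * ρ).trace = ((∑ i, h.eigenvalues i ^ 2 : ℝ) : ℂ) := by
  obtain ⟨h1, -, h3⟩ := h.isDiagonalizedBy
  set U : Matrix n n ℂ := h.eigenvectorUnitary.1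
  set D : Matrix n n ℂ := diagonal fun i => (h.eigenvalues i : ℂ)
  have : ρ * ρ = U * (D * D * Uᴴ) := by
    calc ρ * ρ = U * D * Uᴴ * (U * D * Uᴴ) := by rw [← h3]
      _ = U * (D * ((Uᴴ * U) * (D * Uᴴ))) := by simp only [Matrix.mul_assoc]
      _ = _ := by rw [h1, Matrix.one_mul, Matrix.mul_assoc]
  rw [this, trace_mul_comm, Matrix.mul_assoc, h1, Matrix.mul_one, diagonal_mul_diagonal,
    trace_diagonal]
  push_cast
  exact Finset.sum_congr rfl fun i _ => (sq _).symm

lemma Matrix.IsHermitian.sum_eigenvalues_eq_one {ρ : Matrix n n ℂ} (h : ρ.IsHermitian)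
    (htr : ρ.trace = 1) : ∑ i, h.eigenvalues i = 1 := by
  have := h.trace_eq_sum_eigenvalues
  rw [htr] at this
  exact Complex.ofReal_injective (by simpa using this.symm)

lemma Lent_le_vN {ρ : Matrix n n ℂ} (h : ρ.PosSemidef) (htr : ρ.trace = 1) {P : ℝ}
    (hP : (ρ * ρ).trace = (P : ℂ)) {k : ℕ} (hk : 2 ≤ k) (hk1 : 1 / (k : ℝ) ≤ P)
    (hk2 : P ≤ 1 / ((k : ℝ) - 1)) : Lent P k ≤ vN ρ := by
  rw [vN, dif_pos h.1]
  refine Lent_le _ h.eigenvalues_nonneg (h.1.sum_eigenvalues_eq_one htr) P ?_ k hk hk1 hk2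
  rw [h.1.trace_mul_self_eq_sum] at hP
  exact_mod_cast hP

lemma vN_le_Uent {ρ : Matrix n n ℂ} (h : ρ.PosSemidef) (htr : ρ.trace = 1) {P : ℝ}
    (hP : (ρ * ρ).trace = (P : ℂ)) {d : ℕ} (hd : 2 ≤ d) (hcard : Fintype.card n = d) :
    vN ρ ≤ Uent P d := by
  rw [vN, dif_pos h.1]
  refine le_Uent _ h.eigenvalues_nonneg (h.1.sum_eigenvalues_eq_one htr) P ?_ d hd hcard
  rw [h.1.trace_mul_self_eq_sum] at hP
  exact_mod_cast hP

end Spectrum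

section Marginals

open Matrix

variable {A B C : Type*}

lemma Matrix.PosSemidef.ptraceB [Fintype B] {ρ : Matrix (A × B) (A × B) ℂ}
    (h : ρ.PosSemidef) : (_root_.ptraceB ρ).PosSemidef := by
  have : _root_.ptraceB ρ = _root_.ptraceA (ρ.submatrix Prod.swap Prod.swap) := by
    ext
    simp [_root_.ptraceA, _root_.ptraceB]
  rw [this]
  exact (h.submatrix _).ptraceA

lemma Matrix.PosSemidef.ptraceC3 [Fintype C] {ρ : Matrix (A × B × C) (A × B × C) ℂ}
    (h : ρ.PosSemidef) : (_root_.ptraceC3 ρ).PosSemidef :=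
  (h.submatrix fun x : A × C × B => (x.1, x.2.2, x.2.1)).ptraceB3

variable [Fintype A] [Fintype B] [Fintype C]

lemma trace_ptraceA (ρ : Matrix (A × B) (A × B) ℂ) : (ptraceA ρ).trace = ρ.trace := by
  simp only [trace, diag_apply, ptraceA, of_apply, Fintype.sum_prod_type]
  rw [Finset.sum_comm]

lemma trace_ptraceB (ρ : Matrix (A × B) (A × B) ℂ) : (ptraceB ρ).trace = ρ.trace := by
  simp only [trace, diag_apply, ptraceB, of_apply, Fintype.sum_prod_type]

variable [DecidableEq A] [DecidableEq B] [DecidableEq C]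

/-- Weak monotonicity `S(B) + S(C) ≤ S(AB) + S(AC)`. -/
lemma vN_weak_monotonicity [Nonempty A] [Nonempty B] [Nonempty C]
    {ρ : Matrix (A × B × C) (A × B × C) ℂ} (h : ρ.PosSemidef) :
    vN (ptraceA (ptraceC3 ρ)) + vN (ptraceA (ptraceA ρ)) ≤
      vN (ptraceC3 ρ) + vN (ptraceB3 ρ) := by
  obtain ⟨M, rfl⟩ := h.exists_eq_mul_conjTranspose_self
  let N : Matrix (A × (A × B × C) × B) C ℂ := of fun x c => M (x.1, x.2.2, c) x.2.1
  let K : Matrix ((A × B × C) × B) (A × C) ℂ := of fun x y => M (y.1, x.2, y.2) x.1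
  have hN := condMutualInfo_nonneg (posSemidef_self_mul_conjTranspose N)
  have e1 : ptraceB3 (N * Nᴴ) = ptraceC3 (M * Mᴴ) := by
    ext x y
    simp only [ptraceB3, ptraceC3, of_apply, Matrix.mul_apply, conjTranspose_apply, N]
    rw [Finset.sum_comm]
  have e2 : ptraceA (N * Nᴴ) = K * Kᴴ := by
    ext x y
    simp only [ptraceA, of_apply, Matrix.mul_apply, conjTranspose_apply, N, K,
      Fintype.sum_prod_type (α₁ := A) (α₂ := C)]
  have e3 : (Kᴴ * K)ᵀ = ptraceB3 (M * Mᴴ) := by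
    ext x y
    simp only [ptraceB3, of_apply, transpose_apply, Matrix.mul_apply, conjTranspose_apply, K]
    rw [Fintype.sum_prod_type, Finset.sum_comm]
    simp only [mul_comm]
  have e4 : (Nᴴ * N)ᵀ = ptraceA (ptraceA (M * Mᴴ)) := by
    ext x y
    simp only [ptraceA, of_apply, transpose_apply, Matrix.mul_apply, conjTranspose_apply, N]
    rw [Fintype.sum_prod_type, Finset.sum_comm (s := (Finset.univ : Finset B))]
    refine Finset.sum_congr rfl fun a _ => ?_
    rw [Fintype.sum_prod_type, Finset.sum_comm]
    simp only [mul_comm]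
  have e5 : ptraceA (ptraceA (N * Nᴴ)) = ptraceA (ptraceC3 (M * Mᴴ)) := by
    rw [← ptraceA_ptraceB3, e1]
  rw [condMutualInfo, e5, e1, e2, vN_mul_conjTranspose_self K, e3, vN_mul_conjTranspose_self N,
    e4] at hN
  linarith

lemma vN_ptraceA_sub_le [Nonempty A] [Nonempty B] [Nonempty C]
    {ρ : Matrix (A × B × C) (A × B × C) ℂ} (h : ρ.PosSemidef) :
    vN (ptraceA (ptraceC3 ρ)) - vN (ptraceC3 ρ) ≤ 1 / 2 * condMutualInfo ρ := by
  have hw := vN_weak_monotonicity h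
  let e : A × C × B ≃ A × B × C := (Equiv.refl A).prodCongr (Equiv.prodComm C B)
  have hs := condMutualInfo_nonneg (h.submatrix e)
  have e1 : ptraceB3 (ρ.submatrix e e) = ptraceC3 ρ := rfl
  have e2 : ptraceA (ρ.submatrix e e) =
      (ptraceA ρ).submatrix (Equiv.prodComm C B) (Equiv.prodComm C B) := rfl
  rw [condMutualInfo, ← ptraceA_ptraceB3, e1, e2, vN_submatrix_equiv h.1,
    vN_submatrix_equiv h.ptraceA.1] at hs
  rw [condMutualInfo]
  linarith

lemma vN_ptraceB_sub_le [Nonempty A] [Nonempty B] [Nonempty C]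
    {ρ : Matrix (A × B × C) (A × B × C) ℂ} (h : ρ.PosSemidef) :
    vN (ptraceB (ptraceC3 ρ)) - vN (ptraceC3 ρ) ≤ 1 / 2 * condMutualInfo ρ := by
  let e : B × A × C ≃ A × B × C :=
    ((Equiv.prodAssoc B A C).symm.trans ((Equiv.prodComm B A).prodCongr (Equiv.refl C))).trans
      (Equiv.prodAssoc A B C)
  have hs := vN_ptraceA_sub_le (h.submatrix e)
  have e1 : ptraceB3 (ρ.submatrix e e) = ptraceA ρ := rfl
  have e2 : ptraceA (ρ.submatrix e e) = ptraceB3 ρ := rfl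
  have e3 : ptraceC3 (ρ.submatrix e e) =
      (ptraceC3 ρ).submatrix (Equiv.prodComm B A) (Equiv.prodComm B A) := rfl
  have e4 : ptraceA (ptraceC3 (ρ.submatrix e e)) = ptraceB (ptraceC3 ρ) := rfl
  rw [e4, e3, vN_submatrix_equiv h.ptraceC3.1, condMutualInfo, e1, e2, ptraceA_ptraceB3,
    vN_submatrix_equiv h.1] at hs
  rw [condMutualInfo]
  linarith

end Marginals

/-- for any density matrix `ρ_AB` with marginal purities `P_A, P_B`,
global purity `P_AB`, and any finite-dimensional extension `ρ_ABC` of `ρ_AB`,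
`(1/2) I(A:B|C) ≥ max{L(P_A), L(P_B)} − U(P_AB, d_A d_B)`. -/
theorem half_cmi_ge_purity_bounds
    (dA dB : ℕ) (hdA : 2 ≤ dA) (hdB : 2 ≤ dB)
    (ρAB : Matrix (Fin dA × Fin dB) (Fin dA × Fin dB) ℂ)
    (hρ : ρAB.PosSemidef) (htr : ρAB.trace = 1)
    (PA PB PAB : ℝ)
    (hPA : (ptraceB ρAB * ptraceB ρAB).trace = (PA : ℂ))
    (hPB : (ptraceA ρAB * ptraceA ρAB).trace = (PB : ℂ))
    (hPAB : (ρAB * ρAB).trace = (PAB : ℂ))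
    (kA : ℕ) (hkA : 2 ≤ kA) (hkA1 : 1 / (kA : ℝ) ≤ PA) (hkA2 : PA ≤ 1 / ((kA : ℝ) - 1))
    (kB : ℕ) (hkB : 2 ≤ kB) (hkB1 : 1 / (kB : ℝ) ≤ PB) (hkB2 : PB ≤ 1 / ((kB : ℝ) - 1)) :
    ∀ (dC : ℕ) (ρABC : Matrix (Fin dA × Fin dB × Fin dC) (Fin dA × Fin dB × Fin dC) ℂ),
      ρABC.PosSemidef → ρABC.trace = 1 → ptraceC3 ρABC = ρAB →
      (1 / 2) * condMutualInfo ρABC ≥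
        max (Lent PA kA) (Lent PB kB) - Uent PAB (dA * dB) := by
  intro dC ρABC h htrC hC
  have hne : Nonempty (Fin dA × Fin dB × Fin dC) := by
    by_contra hempty
    rw [not_nonempty_iff] at hempty
    simp [Matrix.trace] at htrC
  obtain ⟨⟨a, b, c⟩⟩ := hne
  have : Nonempty (Fin dA) := ⟨a⟩
  have : Nonempty (Fin dB) := ⟨b⟩
  have : Nonempty (Fin dC) := ⟨c⟩
  have hA := vN_ptraceB_sub_le h
  have hB := vN_ptraceA_sub_le h
  rw [hC] at hA hB
  have hLA := Lent_le_vN hρ.ptraceB ((trace_ptraceB ρAB).trans htr) hPA hkA hkA1 hkA2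
  have hLB := Lent_le_vN hρ.ptraceA ((trace_ptraceA ρAB).trans htr) hPB hkB hkB1 hkB2
  have hU := vN_le_Uent hρ htr hPAB (d := dA * dB) (by nlinarith) (by simp)
  rw [ge_iff_le, sub_le_iff_le_add, max_le_iff]
  constructor <;> linarith
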